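/- Let N ≥ 1, 0 < γ < min{2,N}, p > p_γ := 1 + (2−γ)/N and z ∈ ℝ^N (z = 0 allowed). There exists a constant c* > 0 depending only on N, p, γ (and not on z) such that if u₀ is a nonnegative measurable function on ℝ^N satisfying u₀(x) ≤ c |x−z|^{−(2−γ)/(p−1)} for all x ∈ ℝ^N \ {z} with 0 < c ≤ c*, then the Hardy parabolic equation ∂_t u − Δu = |x|^{−γ} u^p with initial data u₀ possesses a global-in-time solution on ℝ^N × [0,∞). -/

import Mathlib

open MeasureTheory Real Set

noncomputable def heatKernel (N : ℕ) (x : EuclideanSpace ℝ (Fin N)) (t : ℝ) : ℝ :=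
  (4 * Real.pi * t) ^ (-(N : ℝ) / 2) * Real.exp (-‖x‖ ^ 2 / (4 * t))

/-- `u` is a (nonnegative, integral) solution of `∂_t u - Δu = |x|^{-γ} u^p`
with initial data the nonnegative measurable function `u₀`, on `ℝ^N × [0,∞)`. -/
def IsGlobalSol (N : ℕ) (γ p : ℝ) (u₀ : EuclideanSpace ℝ (Fin N) → ℝ)
    (u : EuclideanSpace ℝ (Fin N) → ℝ → ℝ) : Prop :=
  Measurable (Function.uncurry u) ∧ (∀ x t, 0 ≤ u x t) ∧
    ∀ᵐ q : EuclideanSpace ℝ (Fin N) × ℝ,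
      0 < q.2 →
        u q.1 q.2 = (∫ y, heatKernel N (q.1 - y) q.2 * u₀ y) +
          ∫ s in Set.Ioo 0 q.2, ∫ y,
            heatKernel N (q.1 - y) (q.2 - s) * ‖y‖ ^ (-γ) * u y s ^ p

theorem exists_measurable_fixedPoint {X : Type*} [MeasurableSpace X] (μ : Measure X) [SFinite μ]
    {p : ℝ} (hp : 0 < p) {a : X → ENNReal} (ha : Measurable a) {k : X → X → ENNReal}
    (hk : Measurable (Function.uncurry k)) {U : X → ENNReal}
    (hU : ∀ q, a q + ∫⁻ r, k q r * U r ^ p ∂μ ≤ U q) :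
    ∃ u : X → ENNReal, Measurable u ∧ u ≤ U ∧ ∀ q, u q = a q + ∫⁻ r, k q r * u r ^ p ∂μ := by
  let Φ : (X → ENNReal) → X → ENNReal := fun v q => a q + ∫⁻ r, k q r * v r ^ p ∂μ
  have hΦmono : Monotone Φ := fun v w hvw q => by
    dsimp only [Φ]
    gcongr with r
    exact hvw r
  have hΦmeas : ∀ v, Measurable v → Measurable (Φ v) := fun v hv => by
    refine ha.add (Measurable.lintegral_prod_right' (f := fun z : X × X => k z.1 z.2 * v z.2 ^ p) ?_)
    exact Measurable.mul hk ((hv.comp measurable_snd).pow_const p)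
  let w : ℕ → X → ENNReal := fun n => Φ^[n] ⊥
  have hw : ∀ n, w (n + 1) = Φ (w n) := fun n => Function.iterate_succ_apply' Φ n ⊥
  have hwmono : Monotone w := hΦmono.monotone_iterate_of_le_map bot_le
  have hwmeas : ∀ n, Measurable (w n) := by
    intro n
    induction n with
    | zero => exact measurable_const
    | succ n ih => rw [hw]; exact hΦmeas _ ih
  have hwU : ∀ n, w n ≤ U := by
    intro n
    induction n with
    | zero => exact bot_le
    | succ n ih => rw [hw]; exact (hΦmono ih).trans hU
  refine ⟨fun q => ⨆ n, w n q, Measurable.iSup hwmeas, fun q => iSup_le fun n => hwU n q, ?_⟩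
  intro q
  have hpow : ∀ r, k q r * (⨆ n, w n r) ^ p = ⨆ n, k q r * w n r ^ p := by
    intro r
    have := (ENNReal.orderIsoRpow p hp).map_iSup (fun n => w n r)
    simp only [ENNReal.orderIsoRpow_apply] at this
    rw [this, ENNReal.mul_iSup]
  have hkq : Measurable (k q) := hk.comp measurable_prodMk_left
  simp only [hpow]
  rw [lintegral_iSup (f := fun n r => k q r * w n r ^ p)
    (fun n => hkq.mul ((hwmeas n).pow_const p)), ENNReal.add_iSup]
  · refine le_antisymm (iSup_le fun n => ?_) (iSup_le fun n => ?_)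
    · exact (hwmono (Nat.le_succ n) q).trans
        ((congrFun (hw n) q).le.trans (le_iSup (fun n => a q + ∫⁻ r, k q r * w n r ^ p ∂μ) n))
    · exact (congrFun (hw n) q).ge.trans (le_iSup (fun n => w n q) (n + 1))
  · intro m n hmn r
    dsimp only
    gcongr
    exact hwmono hmn r

theorem ENNReal.rpow_neg_le_rpow_neg {a b : ENNReal} (h : a ≤ b) {s : ℝ} (hs : 0 ≤ s) :
    b ^ (-s) ≤ a ^ (-s) := by
  rw [ENNReal.rpow_neg, ENNReal.rpow_neg]
  gcongr

theorem ENNReal.rpow_neg_mul_rpow_neg {a : ENNReal} (h : a ≠ ⊤) {s t : ℝ} (hs : 0 ≤ s)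
    (ht : 0 ≤ t) : a ^ (-s) * a ^ (-t) = a ^ (-(s + t)) := by
  simp only [ENNReal.rpow_neg]
  rw [ENNReal.rpow_add_of_nonneg _ _ hs ht, ENNReal.mul_inv]
  · exact Or.inr (ENNReal.rpow_ne_top_of_nonneg ht h)
  · exact Or.inl (ENNReal.rpow_ne_top_of_nonneg hs h)

theorem integrableOn_Ioo_rpow_neg {s t : ℝ} (hs : s < 1) (ht : 0 < t) :
    IntegrableOn (fun r : ℝ => r ^ (-s)) (Ioo 0 t) :=
  (intervalIntegrable_iff_integrableOn_Ioo_of_le ht.le).1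
    (intervalIntegral.intervalIntegrable_rpow' (by linarith))

theorem integral_Ioo_rpow_neg {s t : ℝ} (hs : s < 1) (ht : 0 < t) :
    ∫ r in Ioo 0 t, r ^ (-s) = 1 / (1 - s) * t ^ (1 - s) := by
  rw [← integral_Ioc_eq_integral_Ioo, ← intervalIntegral.integral_of_le ht.le,
    integral_rpow (Or.inl (by linarith)), Real.zero_rpow (by linarith),
    show -s + 1 = 1 - s by ring]
  ring

theorem lintegral_Ioo_rpow_neg {s t : ℝ} (hs : s < 1) (ht : 0 < t) :
    ∫⁻ r in Ioo 0 t, ENNReal.ofReal r ^ (-s) =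
      ENNReal.ofReal (1 / (1 - s)) * ENNReal.ofReal t ^ (1 - s) := by
  have h1 : ∫⁻ r in Ioo 0 t, ENNReal.ofReal r ^ (-s) =
      ∫⁻ r in Ioo 0 t, ENNReal.ofReal (r ^ (-s)) :=
    setLIntegral_congr_fun measurableSet_Ioo fun r hr => ENNReal.ofReal_rpow_of_pos hr.1
  rw [h1, ← ofReal_integral_eq_lintegral_ofReal (integrableOn_Ioo_rpow_neg hs ht)
    ((ae_restrict_iff' measurableSet_Ioo).2 (.of_forall fun r hr => Real.rpow_nonneg hr.1.le _)),
    integral_Ioo_rpow_neg hs ht,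
    ENNReal.ofReal_rpow_of_pos ht, ← ENNReal.ofReal_mul (by apply one_div_nonneg.2; linarith)]

theorem lintegral_Ioo_sub_left (f : ℝ → ENNReal) (t : ℝ) :
    ∫⁻ r in Ioo 0 t, f (t - r) = ∫⁻ r in Ioo 0 t, f r := by
  rw [← lintegral_indicator measurableSet_Ioo, ← lintegral_indicator measurableSet_Ioo,
    ← lintegral_sub_left_eq_self ((Ioo 0 t).indicator f) t]
  refine lintegral_congr fun r => ?_
  simp only [indicator, mem_Ioo]
  refine if_congr ?_ rfl rfl
  constructor <;> rintro ⟨h1, h2⟩ <;> constructor <;> linarith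

theorem ae_enorm_rpow_eq_ofReal {E : Type*} [NormedAddCommGroup E] [MeasurableSpace E]
    (μ : Measure E) [NullSingletonClass μ] (β : ℝ) :
    ∀ᵐ y ∂μ, ‖y‖ₑ ^ β = ENNReal.ofReal (‖y‖ ^ β) := by
  filter_upwards [μ.ae_ne 0] with y hy
  rw [← ofReal_norm, ENNReal.ofReal_rpow_of_pos (norm_pos_iff.2 hy)]

theorem exists_lintegral_ball_enorm_rpow_le {E : Type*} [NormedAddCommGroup E] [NormedSpace ℝ E]
    [FiniteDimensional ℝ E] [MeasurableSpace E] [BorelSpace E] [Nontrivial E] (μ : Measure E)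
    [μ.IsAddHaarMeasure] {β : ℝ} (hβ : β < Module.finrank ℝ E) :
    ∃ C : ENNReal, C ≠ ⊤ ∧ ∀ R : ℝ, 0 < R →
      ∫⁻ y in Metric.ball (0 : E) R, ‖y‖ₑ ^ (-β) ∂μ ≤
        C * ENNReal.ofReal R ^ ((Module.finrank ℝ E : ℝ) - β) := by
  set d := Module.finrank ℝ E with hd
  have hd1 : 1 ≤ d := Module.finrank_pos
  set σ : ℝ := 1 - (d - β) with hσ
  have hσ1 : σ < 1 := by linarith
  have hpow : ∀ r : ℝ, 0 < r → r ^ (d - 1) • r ^ (-β) = r ^ (-σ) := by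
    intro r hr
    rw [smul_eq_mul, ← Real.rpow_natCast, ← Real.rpow_add hr]
    congr 1
    push_cast [hd1]
    ring
  have hnn : 0 ≤ 1 / (1 - σ) := one_div_nonneg.2 (by linarith)
  refine ⟨ENNReal.ofReal (d * (μ.real (Metric.ball 0 1) * (1 / (1 - σ)))),
    ENNReal.ofReal_ne_top, fun R hR => le_of_eq ?_⟩
  have hint : IntegrableOn (fun y : E => ‖y‖ ^ (-β)) (Metric.ball 0 R) μ :=
    (integrableOn_fun_norm_addHaar μ (f := fun r => r ^ (-β))).2
      ((integrableOn_Ioo_rpow_neg hσ1 hR).congr_fun (fun r hr => (hpow r hr.1).symm)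
        measurableSet_Ioo)
  have hval : ∫ y in Metric.ball (0 : E) R, ‖y‖ ^ (-β) ∂μ =
      d * (μ.real (Metric.ball 0 1) * (1 / (1 - σ))) * R ^ (1 - σ) := by
    have h1 := integral_fun_norm_addHaar μ ((Iio R).indicator fun r : ℝ => r ^ (-β))
    have h2 : ∀ y : E, (Iio R).indicator (fun r : ℝ => r ^ (-β)) ‖y‖ =
        (Metric.ball (0 : E) R).indicator (fun y => ‖y‖ ^ (-β)) y := fun y => by
      simp [indicator]
    have h3 : ∫ r in Ioi (0 : ℝ), r ^ (d - 1) • (Iio R).indicator (fun r : ℝ => r ^ (-β)) r =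
        ∫ r in Ioo 0 R, r ^ (-σ) := by
      rw [← Ioi_inter_Iio, ← setIntegral_indicator measurableSet_Iio]
      refine setIntegral_congr_fun measurableSet_Ioi fun r hr => ?_
      simp only [indicator]
      split_ifs
      · exact hpow r hr
      · simp
    rw [← integral_indicator measurableSet_ball]
    simp only [h2] at h1
    rw [h1, h3, integral_Ioo_rpow_neg hσ1 hR]
    simp only [nsmul_eq_mul, smul_eq_mul]
    ring
  rw [lintegral_congr_ae (ae_restrict_of_ae (ae_enorm_rpow_eq_ofReal μ (-β))),
    ← ofReal_integral_eq_lintegral_ofReal hint (.of_forall fun y => by positivity), hval,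
    ENNReal.ofReal_rpow_of_pos hR, ← ENNReal.ofReal_mul (by positivity)]
  congr 3
  ring

/-- The heat kernel with values in `ENNReal`, extended by zero to nonpositive times. -/
noncomputable def eheatKernel (N : ℕ) (x : EuclideanSpace ℝ (Fin N)) (t : ℝ) : ENNReal :=
  if 0 < t then ENNReal.ofReal (heatKernel N x t) else 0

theorem measurable_heatKernel (N : ℕ) :
    Measurable fun q : EuclideanSpace ℝ (Fin N) × ℝ => heatKernel N q.1 q.2 := by
  unfold heatKernel
  fun_prop

theorem heatKernel_nonneg (N : ℕ) (x : EuclideanSpace ℝ (Fin N)) {t : ℝ} (ht : 0 ≤ t) :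
    0 ≤ heatKernel N x t := by
  unfold heatKernel
  positivity

theorem measurable_eheatKernel (N : ℕ) :
    Measurable fun q : EuclideanSpace ℝ (Fin N) × ℝ => eheatKernel N q.1 q.2 :=
  Measurable.ite (measurableSet_lt measurable_const measurable_snd)
    (measurable_heatKernel N).ennreal_ofReal measurable_const

theorem eheatKernel_of_pos (N : ℕ) (x : EuclideanSpace ℝ (Fin N)) {t : ℝ} (ht : 0 < t) :
    eheatKernel N x t = ENNReal.ofReal (heatKernel N x t) := if_pos ht

theorem eheatKernel_of_nonpos (N : ℕ) (x : EuclideanSpace ℝ (Fin N)) {t : ℝ} (ht : t ≤ 0) :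
    eheatKernel N x t = 0 := if_neg ht.not_gt

theorem lintegral_eheatKernel (N : ℕ) (x : EuclideanSpace ℝ (Fin N)) {t : ℝ} (ht : 0 < t) :
    ∫⁻ y, eheatKernel N (x - y) t = 1 := by
  rw [lintegral_sub_left_eq_self (fun y => eheatKernel N y t) x]
  have hval := GaussianFourier.integral_rexp_neg_mul_sq_norm
    (V := EuclideanSpace ℝ (Fin N)) (b := 1 / (4 * t)) (by positivity)
  have hint : ∫ y : EuclideanSpace ℝ (Fin N), heatKernel N y t = 1 := by
    unfold heatKernel
    have : ∀ y : EuclideanSpace ℝ (Fin N), -‖y‖ ^ 2 / (4 * t) = -(1 / (4 * t)) * ‖y‖ ^ 2 :=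
      fun y => by ring
    simp only [this]
    rw [integral_const_mul, hval, finrank_euclideanSpace_fin,
      show π / (1 / (4 * t)) = 4 * π * t by field_simp, ← Real.rpow_add (by positivity)]
    rw [show -(N : ℝ) / 2 + N / 2 = 0 by ring, Real.rpow_zero]
  have hI : Integrable fun y : EuclideanSpace ℝ (Fin N) => heatKernel N y t := by
    by_contra h
    rw [integral_undef h] at hint
    exact zero_ne_one hint
  simp only [eheatKernel_of_pos N _ ht]
  rw [← ofReal_integral_eq_lintegral_ofReal hI
    (.of_forall fun y => heatKernel_nonneg N y ht.le), hint, ENNReal.ofReal_one]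

theorem heatKernel_le {N : ℕ} (hN : 1 ≤ N) (x : EuclideanSpace ℝ (Fin N)) {t R : ℝ} (ht : 0 < t)
    (hR : 0 < R) (h : R ≤ √t ∨ R ≤ ‖x‖) :
    heatKernel N x t ≤ (N : ℝ) ^ ((N : ℝ) / 2) * R ^ (-(N : ℝ)) := by
  have hN' : (1 : ℝ) ≤ N := by exact_mod_cast hN
  have hπ : 3 < π := Real.pi_gt_three
  have hRN : R ^ (-(N : ℝ)) = (R ^ 2) ^ (-(N : ℝ) / 2) := by
    rw [← Real.rpow_natCast, ← Real.rpow_mul hR.le]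
    congr 1
    push_cast
    ring
  have hsplit : (N : ℝ) ^ ((N : ℝ) / 2) * R ^ (-(N : ℝ)) = (R ^ 2 / N) ^ (-(N : ℝ) / 2) := by
    rw [hRN, Real.div_rpow (by positivity) (by positivity), neg_div,
      Real.rpow_neg (by positivity : (0 : ℝ) ≤ N), div_inv_eq_mul, mul_comm]
  rw [hsplit]
  unfold heatKernel
  have hexp1 : Real.exp (-‖x‖ ^ 2 / (4 * t)) ≤ 1 := by
    rw [Real.exp_le_one_iff]
    exact div_nonpos_of_nonpos_of_nonneg (by simp) (by positivity)
  rcases h with h | h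
  · calc _ ≤ (4 * π * t) ^ (-(N : ℝ) / 2) * 1 := by gcongr
      _ = (4 * π * t) ^ (-(N : ℝ) / 2) := mul_one _
      _ ≤ _ := by
        refine Real.rpow_le_rpow_of_nonpos (by positivity) ?_ (by linarith)
        have : R ^ 2 ≤ t := by
          calc R ^ 2 ≤ √t ^ 2 := by gcongr
            _ = t := Real.sq_sqrt ht.le
        calc R ^ 2 / N ≤ R ^ 2 := div_le_self (by positivity) hN'
          _ ≤ t := this
          _ ≤ 4 * π * t := by nlinarith
  · set u : ℝ := ‖x‖ ^ 2 / (2 * N * t) with hu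
    have hx : 0 < ‖x‖ := hR.trans_le h
    have hu0 : 0 < u := by positivity
    have h1 : Real.exp (-‖x‖ ^ 2 / (4 * t)) = Real.exp u ^ (-(N : ℝ) / 2) := by
      rw [← Real.exp_mul]
      congr 1
      rw [hu]
      field_simp
      ring
    have h2 : Real.exp u ^ (-(N : ℝ) / 2) ≤ u ^ (-(N : ℝ) / 2) :=
      Real.rpow_le_rpow_of_nonpos hu0 (by linarith [Real.add_one_le_exp u]) (by linarith)
    rw [h1]
    calc _ ≤ (4 * π * t) ^ (-(N : ℝ) / 2) * u ^ (-(N : ℝ) / 2) := by gcongr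
      _ = (4 * π * t * u) ^ (-(N : ℝ) / 2) :=
        (Real.mul_rpow (by positivity) hu0.le).symm
      _ ≤ _ := by
        refine Real.rpow_le_rpow_of_nonpos (by positivity) ?_ (by linarith)
        have h3 : 4 * π * t * u = 2 * π * (‖x‖ ^ 2 / N) := by
          rw [hu]
          field_simp
          ring
        rw [h3]
        calc R ^ 2 / N ≤ ‖x‖ ^ 2 / N := by gcongr
          _ ≤ 2 * π * (‖x‖ ^ 2 / N) := by
            have : 0 ≤ ‖x‖ ^ 2 / N := by positivity
            nlinarith

/-- The parabolic norm `max(‖x‖, √t)`. -/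
noncomputable def parabolicNorm {E : Type*} [NormedAddCommGroup E] (x : E) (t : ℝ) : ENNReal :=
  max ‖x‖ₑ (ENNReal.ofReal t ^ (1 / 2 : ℝ))

section parabolicNorm

variable {E : Type*} [NormedAddCommGroup E]

theorem parabolicNorm_eq_ofReal (x : E) {t : ℝ} (ht : 0 < t) :
    parabolicNorm x t = ENNReal.ofReal (max ‖x‖ (√t)) := by
  rw [parabolicNorm, ENNReal.ofReal_max, ofReal_norm, Real.sqrt_eq_rpow,
    ENNReal.ofReal_rpow_of_pos ht]

theorem parabolicNorm_ne_zero (x : E) {t : ℝ} (ht : 0 < t) : parabolicNorm x t ≠ 0 := by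
  rw [parabolicNorm_eq_ofReal x ht]
  have := Real.sqrt_pos.2 ht
  simp [ht]

theorem parabolicNorm_ne_top (x : E) {t : ℝ} (ht : 0 < t) : parabolicNorm x t ≠ ⊤ := by
  rw [parabolicNorm_eq_ofReal x ht]
  exact ENNReal.ofReal_ne_top

theorem measurable_parabolicNorm [MeasurableSpace E] [OpensMeasurableSpace E] :
    Measurable fun q : E × ℝ => parabolicNorm q.1 q.2 := by
  unfold parabolicNorm
  fun_prop

end parabolicNorm

theorem exists_lintegral_eheatKernel_mul_rpow_le {N : ℕ} (hN : 1 ≤ N) {β : ℝ} (hβ0 : 0 ≤ β)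
    (hβ : β < N) :
    ∃ K : ENNReal, K ≠ ⊤ ∧ ∀ (x : EuclideanSpace ℝ (Fin N)) (t : ℝ), 0 < t →
      ∫⁻ y, eheatKernel N (x - y) t * ‖y‖ₑ ^ (-β) ≤ K * parabolicNorm x t ^ (-β) := by
  have : Nonempty (Fin N) := ⟨⟨0, hN⟩⟩
  obtain ⟨C, hC, hball⟩ := exists_lintegral_ball_enorm_rpow_le
    (volume : Measure (EuclideanSpace ℝ (Fin N))) (β := β) (by simpa using hβ)
  rw [finrank_euclideanSpace_fin] at hball
  set D : ENNReal := ENNReal.ofReal ((N : ℝ) ^ ((N : ℝ) / 2)) with hD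
  refine ⟨(D * C + 1) * ENNReal.ofReal (2 ^ β), by finiteness, fun x t ht => ?_⟩
  set ρ : ℝ := max ‖x‖ (√t) with hρ
  have hρ0 : 0 < ρ := lt_max_of_lt_right (Real.sqrt_pos.2 ht)
  set R : ℝ := ρ / 2 with hR
  have hR0 : 0 < R := by positivity
  have hker : ∀ y ∈ Metric.ball (0 : EuclideanSpace ℝ (Fin N)) R,
      eheatKernel N (x - y) t ≤ D * ENNReal.ofReal R ^ (-(N : ℝ)) := by
    intro y hy
    rw [mem_ball_zero_iff] at hy
    rw [eheatKernel_of_pos N _ ht, ENNReal.ofReal_rpow_of_pos hR0, hD,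
      ← ENNReal.ofReal_mul (by positivity)]
    refine ENNReal.ofReal_le_ofReal (heatKernel_le hN _ ht hR0 ?_)
    rcases le_total ‖x‖ (√t) with h | h
    · left
      rw [hR, hρ, max_eq_right h]
      linarith [Real.sqrt_nonneg t]
    · right
      have h1 : ‖x‖ = 2 * R := by rw [hR, hρ, max_eq_left h]; ring
      have h2 := norm_sub_norm_le x y
      linarith
  have hout : ∀ y ∈ (Metric.ball (0 : EuclideanSpace ℝ (Fin N)) R)ᶜ,
      ‖y‖ₑ ^ (-β) ≤ ENNReal.ofReal R ^ (-β) := by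
    intro y hy
    refine ENNReal.rpow_neg_le_rpow_neg ?_ hβ0
    rw [← ofReal_norm]
    exact ENNReal.ofReal_le_ofReal (by simpa using hy)
  have hRpow : ENNReal.ofReal R ^ (-β) = ENNReal.ofReal (2 ^ β) * parabolicNorm x t ^ (-β) := by
    rw [parabolicNorm_eq_ofReal x ht, ENNReal.ofReal_rpow_of_pos hR0,
      ENNReal.ofReal_rpow_of_pos hρ0, ← ENNReal.ofReal_mul (by positivity), hR,
      Real.div_rpow hρ0.le zero_le_two, Real.rpow_neg zero_le_two, div_inv_eq_mul, mul_comm]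
  rw [mul_assoc, ← hRpow, add_mul, one_mul, ← lintegral_add_compl _ measurableSet_ball
    (A := Metric.ball (0 : EuclideanSpace ℝ (Fin N)) R)]
  have hRne : ENNReal.ofReal R ≠ 0 := by simpa using hR0
  gcongr
  · calc _ ≤ ∫⁻ y in Metric.ball (0 : EuclideanSpace ℝ (Fin N)) R,
          D * ENNReal.ofReal R ^ (-(N : ℝ)) * ‖y‖ₑ ^ (-β) :=
        setLIntegral_mono' measurableSet_ball fun y hy => by gcongr; exact hker y hy
      _ = D * ENNReal.ofReal R ^ (-(N : ℝ)) *
          ∫⁻ y in Metric.ball (0 : EuclideanSpace ℝ (Fin N)) R, ‖y‖ₑ ^ (-β) :=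
        lintegral_const_mul _ (by fun_prop)
      _ ≤ D * ENNReal.ofReal R ^ (-(N : ℝ)) * (C * ENNReal.ofReal R ^ ((N : ℝ) - β)) := by
        gcongr
        exact hball R hR0
      _ = D * C * (ENNReal.ofReal R ^ (-(N : ℝ)) * ENNReal.ofReal R ^ ((N : ℝ) - β)) := by ring
      _ = D * C * ENNReal.ofReal R ^ (-β) := by
        rw [← ENNReal.rpow_add _ _ hRne ENNReal.ofReal_ne_top]
        congr 2
        ring
  · calc _ ≤ ∫⁻ y in (Metric.ball (0 : EuclideanSpace ℝ (Fin N)) R)ᶜ,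
          eheatKernel N (x - y) t * ENNReal.ofReal R ^ (-β) :=
        setLIntegral_mono' measurableSet_ball.compl fun y hy => mul_le_mul' le_rfl (hout y hy)
      _ ≤ ∫⁻ y, eheatKernel N (x - y) t * ENNReal.ofReal R ^ (-β) := setLIntegral_le_lintegral _ _
      _ = ENNReal.ofReal R ^ (-β) := by
        rw [lintegral_mul_const' _ _
          (ENNReal.rpow_ne_top_of_ne_zero hRne ENNReal.ofReal_ne_top),
          lintegral_eheatKernel N x ht, one_mul]

theorem rpow_neg_mul_parabolicNorm_le {E : Type*} [NormedAddCommGroup E] (y : E) {s : ℝ}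
    (hs : 0 < s) {γ q δ τ : ℝ} (hγ : 0 ≤ γ) (hδ : 0 ≤ δ) (hτ : 0 ≤ τ) (hq : q = δ + 2 * τ) :
    ‖y‖ₑ ^ (-γ) * parabolicNorm y s ^ (-q) ≤
      ENNReal.ofReal s ^ (-τ) * ‖y‖ₑ ^ (-(γ + δ)) := by
  rw [← ENNReal.rpow_neg_mul_rpow_neg enorm_ne_top hγ hδ, hq,
    ← ENNReal.rpow_neg_mul_rpow_neg (parabolicNorm_ne_top y hs) hδ (by positivity : 0 ≤ 2 * τ)]
  have h1 : parabolicNorm y s ^ (-δ) ≤ ‖y‖ₑ ^ (-δ) :=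
    ENNReal.rpow_neg_le_rpow_neg (le_max_left _ _) hδ
  have h2 : parabolicNorm y s ^ (-(2 * τ)) ≤ ENNReal.ofReal s ^ (-τ) := by
    refine (ENNReal.rpow_neg_le_rpow_neg (le_max_right _ _) (by positivity)).trans_eq ?_
    rw [← ENNReal.rpow_mul]
    congr 1
    ring
  calc _ ≤ ‖y‖ₑ ^ (-γ) * (‖y‖ₑ ^ (-δ) * ENNReal.ofReal s ^ (-τ)) :=
        mul_le_mul' le_rfl (mul_le_mul' h1 h2)
    _ = _ := by ring

theorem exists_lintegral_duhamel_le {N : ℕ} (hN : 1 ≤ N) {γ α q : ℝ} (hγ0 : 0 < γ) (hγ2 : γ < 2)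
    (hγN : γ < N) (hα0 : 0 < α) (hαN : α < N) (hq : q = α + 2 - γ) :
    ∃ K : ENNReal, K ≠ ⊤ ∧ ∀ (x : EuclideanSpace ℝ (Fin N)) (t : ℝ), 0 < t →
      ∫⁻ s in Ioo 0 t, ∫⁻ y, eheatKernel N (x - y) (t - s) *
        (‖y‖ₑ ^ (-γ) * parabolicNorm y s ^ (-q)) ≤ K * parabolicNorm x t ^ (-α) := by
  obtain ⟨β, hβ1, hβ2⟩ : ∃ β, max α γ < β ∧ β < min (N : ℝ) (α + 2) :=
    exists_between (max_lt (lt_min hαN (by linarith)) (lt_min hγN (by linarith)))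
  obtain ⟨hαβ, hγβ⟩ := max_lt_iff.1 hβ1
  obtain ⟨hβN, hβα⟩ := lt_min_iff.1 hβ2
  have hβ0 : 0 ≤ β := by linarith
  obtain ⟨K₁, hK₁, hH₁⟩ := exists_lintegral_eheatKernel_mul_rpow_le hN hβ0 hβN
  obtain ⟨K₂, hK₂, hH₂⟩ := exists_lintegral_eheatKernel_mul_rpow_le hN hγ0.le hγN
  obtain ⟨σ, hσ⟩ : ∃ σ : ℝ, σ = (α + 2 - β) / 2 := ⟨_, rfl⟩
  have hσ0 : 0 ≤ σ := by linarith
  have hσ1 : σ < 1 := by linarith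
  have hinner : ∀ (δ τ : ℝ) (K : ENNReal), 0 ≤ δ → 0 ≤ τ → q = δ + 2 * τ →
      (∀ (x : EuclideanSpace ℝ (Fin N)) (t : ℝ), 0 < t →
        ∫⁻ y, eheatKernel N (x - y) t * ‖y‖ₑ ^ (-(γ + δ)) ≤ K * parabolicNorm x t ^ (-(γ + δ))) →
      ∀ (x : EuclideanSpace ℝ (Fin N)) (t s : ℝ), 0 < s → s < t →
        ∫⁻ y, eheatKernel N (x - y) (t - s) * (‖y‖ₑ ^ (-γ) * parabolicNorm y s ^ (-q)) ≤
          ENNReal.ofReal s ^ (-τ) * (K * parabolicNorm x (t - s) ^ (-(γ + δ))) := by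
    intro δ τ K hδ hτ hqe hK x t s hs hst
    calc _ ≤ ∫⁻ y, ENNReal.ofReal s ^ (-τ) *
            (eheatKernel N (x - y) (t - s) * ‖y‖ₑ ^ (-(γ + δ))) := by
          refine lintegral_mono fun y => ?_
          refine (mul_le_mul' le_rfl
            (rpow_neg_mul_parabolicNorm_le y hs hγ0.le hδ hτ hqe)).trans_eq ?_
          ring
      _ = ENNReal.ofReal s ^ (-τ) *
            ∫⁻ y, eheatKernel N (x - y) (t - s) * ‖y‖ₑ ^ (-(γ + δ)) :=
          lintegral_const_mul' _ _
            (ENNReal.rpow_ne_top_of_ne_zero (by simpa using hs) ENNReal.ofReal_ne_top)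
      _ ≤ _ := by
          gcongr
          exact hK x (t - s) (by linarith)
  have hin₁ := hinner (β - γ) σ K₁ (by linarith) hσ0 (by linarith)
    (by simpa [add_sub_cancel] using hH₁)
  have hin₂ := hinner 0 (q / 2) K₂ le_rfl (by linarith) (by ring) (by simpa using hH₂)
  simp only [add_sub_cancel, add_zero] at hin₁ hin₂
  set C₁ : ENNReal := ENNReal.ofReal (1 / (1 - σ)) with hC₁
  set C₂ : ENNReal := ENNReal.ofReal (1 / (1 - γ / 2)) with hC₂
  refine ⟨K₁ * C₁ + (K₁ * C₁ * 2 ^ (β / 2) + K₂ * C₂ * 2 ^ (q / 2)), by finiteness, fun x t ht => ?_⟩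
  have hρ0 := parabolicNorm_ne_zero x ht
  have hρt := parabolicNorm_ne_top x ht
  obtain ⟨T, hT⟩ : ∃ T : ENNReal, T = ENNReal.ofReal t := ⟨_, rfl⟩
  have hT0 : T ≠ 0 := by simpa [hT] using ht
  have hTt : T ≠ ⊤ := hT ▸ ENNReal.ofReal_ne_top
  rw [add_mul]
  rcases le_total (ENNReal.ofReal t ^ (1 / 2 : ℝ)) ‖x‖ₑ with h | h
  · refine le_trans ?_ le_self_add
    have hρ : parabolicNorm x t = ‖x‖ₑ := max_eq_left h
    calc _ ≤ ∫⁻ s in Ioo 0 t, ENNReal.ofReal s ^ (-σ) * (K₁ * ‖x‖ₑ ^ (-β)) := by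
          refine setLIntegral_mono' measurableSet_Ioo fun s hs => ?_
          refine (hin₁ x t s hs.1 hs.2).trans ?_
          exact mul_le_mul' le_rfl (mul_le_mul' le_rfl
            (ENNReal.rpow_neg_le_rpow_neg (le_max_left _ _) hβ0))
      _ = C₁ * T ^ (1 - σ) * (K₁ * ‖x‖ₑ ^ (-β)) := by
          rw [lintegral_mul_const _ (by fun_prop), lintegral_Ioo_rpow_neg hσ1 ht, hT]
      _ ≤ C₁ * ‖x‖ₑ ^ (β - α) * (K₁ * ‖x‖ₑ ^ (-β)) := by
          gcongr
          calc T ^ (1 - σ) = (T ^ (1 / 2 : ℝ)) ^ (β - α) := by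
                rw [← ENNReal.rpow_mul]
                congr 1
                rw [hσ]
                ring
            _ ≤ ‖x‖ₑ ^ (β - α) := by
                rw [hT]
                exact ENNReal.rpow_le_rpow h (by linarith)
      _ = K₁ * C₁ * (‖x‖ₑ ^ (β - α) * ‖x‖ₑ ^ (-β)) := by ring
      _ = K₁ * C₁ * parabolicNorm x t ^ (-α) := by
          rw [hρ] at hρ0 hρt ⊢
          rw [← ENNReal.rpow_add _ _ hρ0 hρt]
          congr 2
          ring
  · refine le_trans ?_ le_add_self
    have hρ : parabolicNorm x t = T ^ (1 / 2 : ℝ) := by rw [hT]; exact max_eq_right h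
    have hhalf : ∀ b : ℝ, 0 ≤ b → (T / 2) ^ (-b) = 2 ^ b * T ^ (-b) := by
      intro b hb
      rw [ENNReal.rpow_neg, ENNReal.div_rpow_of_nonneg _ _ hb, ENNReal.inv_div
        (Or.inl (by finiteness)) (Or.inl (by simp)),
        ENNReal.rpow_neg, div_eq_mul_inv]
    have hhT : ∀ r : ℝ, t / 2 ≤ r → T / 2 ≤ ENNReal.ofReal r := by
      intro r hr
      refine le_trans (le_of_eq ?_) (ENNReal.ofReal_le_ofReal hr)
      rw [ENNReal.ofReal_div_of_pos two_pos, hT, ENNReal.ofReal_ofNat]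
    have hnorm : ∀ (b r : ℝ), 0 ≤ b → parabolicNorm x r ^ (-b) ≤ ENNReal.ofReal r ^ (-(b / 2)) := by
      intro b r hb
      refine (ENNReal.rpow_neg_le_rpow_neg (le_max_right _ _) hb).trans_eq ?_
      rw [← ENNReal.rpow_mul]
      congr 1
      ring
    calc _ ≤ ∫⁻ s in Ioo 0 t, (ENNReal.ofReal s ^ (-σ) * (K₁ * (T / 2) ^ (-(β / 2))) +
            (T / 2) ^ (-(q / 2)) * K₂ * ENNReal.ofReal (t - s) ^ (-(γ / 2))) := by
          refine setLIntegral_mono' measurableSet_Ioo fun s hs => ?_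
          rcases le_total s (t / 2) with hs2 | hs2
          · refine (hin₁ x t s hs.1 hs.2).trans (le_trans ?_ le_self_add)
            refine mul_le_mul' le_rfl (mul_le_mul' le_rfl ((hnorm β _ hβ0).trans ?_))
            exact ENNReal.rpow_neg_le_rpow_neg (hhT _ (by linarith)) (by linarith)
          · refine (hin₂ x t s hs.1 hs.2).trans (le_trans ?_ le_add_self)
            rw [mul_assoc]
            refine mul_le_mul' ?_ (mul_le_mul' le_rfl (hnorm γ _ hγ0.le))
            exact ENNReal.rpow_neg_le_rpow_neg (hhT _ hs2) (by linarith)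
      _ = C₁ * T ^ (1 - σ) * (K₁ * (T / 2) ^ (-(β / 2))) +
            (T / 2) ^ (-(q / 2)) * K₂ * (C₂ * T ^ (1 - γ / 2)) := by
          rw [lintegral_add_left (by fun_prop), lintegral_mul_const _ (by fun_prop),
            lintegral_const_mul _ (by fun_prop), lintegral_Ioo_rpow_neg hσ1 ht,
            lintegral_Ioo_sub_left (fun r => ENNReal.ofReal r ^ (-(γ / 2))),
            lintegral_Ioo_rpow_neg (by linarith) ht, hT]
      _ = K₁ * C₁ * 2 ^ (β / 2) * (T ^ (1 - σ) * T ^ (-(β / 2))) +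
            K₂ * C₂ * 2 ^ (q / 2) * (T ^ (1 - γ / 2) * T ^ (-(q / 2))) := by
          rw [hhalf _ (by linarith), hhalf _ (by linarith)]
          ring
      _ = _ := by
          rw [← ENNReal.rpow_add _ _ hT0 hTt, ← ENNReal.rpow_add _ _ hT0 hTt, hρ,
            ← ENNReal.rpow_mul]
          rw [show 1 - σ + -(β / 2) = 1 / 2 * -α by rw [hσ]; ring,
            show 1 - γ / 2 + -(q / 2) = 1 / 2 * -α by rw [hq]; ring, add_mul]

theorem rpow_neg_mul_parabolicNorm_sub_le {E : Type*} [NormedAddCommGroup E] (y z : E) (s : ℝ)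
    {γ q : ℝ} (hγ : 0 ≤ γ) (hq : 0 ≤ q) :
    ‖y‖ₑ ^ (-γ) * parabolicNorm (y - z) s ^ (-q) ≤
      ‖y‖ₑ ^ (-γ) * parabolicNorm y s ^ (-q) +
        ‖y - z‖ₑ ^ (-γ) * parabolicNorm (y - z) s ^ (-q) := by
  rcases le_total ‖y‖ₑ ‖y - z‖ₑ with h | h
  · refine le_trans (mul_le_mul' le_rfl ?_) le_self_add
    exact ENNReal.rpow_neg_le_rpow_neg (max_le_max h le_rfl) hq
  · exact le_trans (mul_le_mul' (ENNReal.rpow_neg_le_rpow_neg h hγ) le_rfl) le_add_self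

/-- The sum of the two profiles `max(‖x‖, √t)^(-α)` centred at `0` and at `z`. -/
noncomputable def twoCentreProfile {E : Type*} [NormedAddCommGroup E] (α : ℝ) (z x : E) (t : ℝ) :
    ENNReal :=
  parabolicNorm x t ^ (-α) + parabolicNorm (x - z) t ^ (-α)

theorem exists_supersolution {N : ℕ} (hN : 1 ≤ N) {γ α p : ℝ} (hγ0 : 0 < γ) (hγ2 : γ < 2)
    (hγN : γ < N) (hα0 : 0 < α) (hαN : α < N) (hp : 1 < p) (hαp : α * p = α + 2 - γ) :
    ∃ (cstar : ℝ) (A : ENNReal), 0 < cstar ∧ A ≠ ⊤ ∧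
      ∀ (z : EuclideanSpace ℝ (Fin N)) (v : EuclideanSpace ℝ (Fin N) → ENNReal),
      (∀ y, v y ≤ ENNReal.ofReal cstar * ‖y - z‖ₑ ^ (-α)) →
      ∀ (x : EuclideanSpace ℝ (Fin N)) (t : ℝ), 0 < t →
        (∫⁻ y, eheatKernel N (x - y) t * v y) +
          ∫⁻ s in Ioo 0 t, ∫⁻ y, eheatKernel N (x - y) (t - s) *
            (‖y‖ₑ ^ (-γ) * (A * twoCentreProfile α z y s) ^ p) ≤
        A * twoCentreProfile α z x t := by
  obtain ⟨K₁, hK₁, hH₁⟩ := exists_lintegral_eheatKernel_mul_rpow_le hN hα0.le hαN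
  obtain ⟨K₂, hK₂, hH₂⟩ := exists_lintegral_duhamel_le hN hγ0 hγ2 hγN hα0 hαN rfl
  rw [← hαp] at hH₂
  obtain ⟨κ, hκ⟩ : ∃ κ : ℝ, κ = (K₁ + K₂).toReal + 1 := ⟨_, rfl⟩
  have hκ0 : 0 < κ := by rw [hκ]; positivity
  have hK : K₁ + K₂ ≤ ENNReal.ofReal κ := by
    rw [ENNReal.le_ofReal_iff_toReal_le (by finiteness) hκ0.le]
    linarith
  obtain ⟨a, ha⟩ : ∃ a : ℝ, a = (2 ^ (p + 2) * κ) ^ (-(1 / (p - 1))) := ⟨_, rfl⟩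
  have ha0 : 0 < a := by rw [ha]; positivity
  have hap : a ^ p * 2 ^ p * (2 * κ) = a / 2 := by
    have h1 : a ^ (p - 1) = (2 ^ (p + 2) * κ)⁻¹ := by
      rw [ha, ← Real.rpow_mul (by positivity), neg_mul, one_div_mul_cancel (by linarith),
        Real.rpow_neg_one]
    have h2 : a ^ p = a * a ^ (p - 1) := by
      rw [Real.rpow_sub_one ha0.ne']
      field_simp
    rw [h2, h1, Real.rpow_add two_pos, show (2 : ℝ) ^ (2 : ℝ) = 4 by norm_num]
    field_simp
    norm_num
  refine ⟨a / (2 * κ), ENNReal.ofReal a, by positivity, ENNReal.ofReal_ne_top,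
    fun z v hv x t ht => ?_⟩
  have hlin : ∫⁻ y, eheatKernel N (x - y) t * v y ≤
      ENNReal.ofReal (a / 2) * twoCentreProfile α z x t := by
    calc _ ≤ ∫⁻ y, ENNReal.ofReal (a / (2 * κ)) *
            (eheatKernel N (x - z - (y - z)) t * ‖y - z‖ₑ ^ (-α)) := by
          refine lintegral_mono fun y => ?_
          refine (mul_le_mul' le_rfl (hv y)).trans_eq ?_
          rw [sub_sub_sub_cancel_right]
          ring
      _ = ENNReal.ofReal (a / (2 * κ)) *
            ∫⁻ y, eheatKernel N (x - z - y) t * ‖y‖ₑ ^ (-α) := by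
          rw [lintegral_const_mul' _ _ ENNReal.ofReal_ne_top, lintegral_sub_right_eq_self
            (fun y => eheatKernel N (x - z - y) t * ‖y‖ₑ ^ (-α)) z]
      _ ≤ ENNReal.ofReal (a / (2 * κ)) *
            (ENNReal.ofReal κ * parabolicNorm (x - z) t ^ (-α)) := by
          refine mul_le_mul' le_rfl ((hH₁ _ t ht).trans ?_)
          exact mul_le_mul' (le_self_add.trans hK) le_rfl
      _ = ENNReal.ofReal (a / 2) * parabolicNorm (x - z) t ^ (-α) := by
          rw [← mul_assoc, ← ENNReal.ofReal_mul (by positivity)]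
          congr 2
          field_simp
      _ ≤ _ := mul_le_mul' le_rfl le_add_self
  have hpt : ∀ (y : EuclideanSpace ℝ (Fin N)) (s : ℝ),
      ‖y‖ₑ ^ (-γ) * (ENNReal.ofReal a * twoCentreProfile α z y s) ^ p ≤
        ENNReal.ofReal (a ^ p * 2 ^ p) * (2 * (‖y‖ₑ ^ (-γ) * parabolicNorm y s ^ (-(α * p))) +
          ‖y - z‖ₑ ^ (-γ) * parabolicNorm (y - z) s ^ (-(α * p))) := by
    intro y s
    have h1 : (ENNReal.ofReal a * twoCentreProfile α z y s) ^ p ≤ ENNReal.ofReal (a ^ p * 2 ^ p) *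
        (parabolicNorm y s ^ (-(α * p)) + parabolicNorm (y - z) s ^ (-(α * p))) := by
      rw [ENNReal.mul_rpow_of_nonneg _ _ (by linarith), ENNReal.ofReal_mul (by positivity),
        ENNReal.ofReal_rpow_of_pos ha0, mul_assoc]
      refine mul_le_mul' le_rfl ((ENNReal.rpow_add_le_mul_rpow_add_rpow _ _ hp.le).trans ?_)
      rw [← ENNReal.rpow_mul, ← ENNReal.rpow_mul, neg_mul]
      refine mul_le_mul' ?_ le_rfl
      rw [← ENNReal.ofReal_rpow_of_pos two_pos, ENNReal.ofReal_ofNat]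
      exact ENNReal.rpow_le_rpow_of_exponent_le (by norm_num) (by linarith)
    have h2 := rpow_neg_mul_parabolicNorm_sub_le y z s hγ0.le (by positivity : 0 ≤ α * p)
    calc _ ≤ ‖y‖ₑ ^ (-γ) * (ENNReal.ofReal (a ^ p * 2 ^ p) *
          (parabolicNorm y s ^ (-(α * p)) + parabolicNorm (y - z) s ^ (-(α * p)))) :=
          mul_le_mul' le_rfl h1
      _ = ENNReal.ofReal (a ^ p * 2 ^ p) * (‖y‖ₑ ^ (-γ) * parabolicNorm y s ^ (-(α * p)) +
          ‖y‖ₑ ^ (-γ) * parabolicNorm (y - z) s ^ (-(α * p))) := by ring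
      _ ≤ _ := by
          refine mul_le_mul' le_rfl ((add_le_add le_rfl h2).trans_eq ?_)
          ring
  obtain ⟨F, hF⟩ : ∃ F : EuclideanSpace ℝ (Fin N) → ℝ × EuclideanSpace ℝ (Fin N) → ENNReal,
    F = fun w r => eheatKernel N (w - r.2) (t - r.1) *
        (‖r.2‖ₑ ^ (-γ) * parabolicNorm r.2 r.1 ^ (-(α * p))) := ⟨_, rfl⟩
  have hFm : ∀ w, Measurable (F w) := by
    rw [hF]
    intro w
    refine ((measurable_eheatKernel N).comp (g := fun q => _)
      (f := fun r : ℝ × EuclideanSpace ℝ (Fin N) => (w - r.2, t - r.1)) (by fun_prop)).mul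
      (Measurable.mul (by fun_prop) (Measurable.pow_const ?_ _))
    exact measurable_parabolicNorm.comp measurable_swap
  have hnonlin : ∫⁻ s in Ioo 0 t, ∫⁻ y, eheatKernel N (x - y) (t - s) *
      (‖y‖ₑ ^ (-γ) * (ENNReal.ofReal a * twoCentreProfile α z y s) ^ p) ≤
      ENNReal.ofReal (a / 2) * twoCentreProfile α z x t := by
    calc _ ≤ ∫⁻ s in Ioo 0 t, ∫⁻ y, ENNReal.ofReal (a ^ p * 2 ^ p) *
            (2 * F x (s, y) + F (x - z) (s, y - z)) := by
          refine lintegral_mono fun s => lintegral_mono fun y => ?_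
          refine (mul_le_mul' le_rfl (hpt y s)).trans_eq ?_
          simp only [hF, sub_sub_sub_cancel_right]
          ring
      _ = ∫⁻ s in Ioo 0 t, ENNReal.ofReal (a ^ p * 2 ^ p) *
            (2 * (∫⁻ y, F x (s, y)) + ∫⁻ y, F (x - z) (s, y)) := by
          refine lintegral_congr fun s => ?_
          have hFs : ∀ w, Measurable fun y => F w (s, y) :=
            fun w => (hFm w).comp measurable_prodMk_left
          rw [lintegral_const_mul' _ _ ENNReal.ofReal_ne_top,
            lintegral_add_left ((hFs x).const_mul 2), lintegral_const_mul _ (hFs x),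
            lintegral_sub_right_eq_self (fun y => F (x - z) (s, y)) z]
      _ = ENNReal.ofReal (a ^ p * 2 ^ p) * (2 * (∫⁻ s in Ioo 0 t, ∫⁻ y, F x (s, y)) +
            ∫⁻ s in Ioo 0 t, ∫⁻ y, F (x - z) (s, y)) := by
          rw [lintegral_const_mul' _ _ ENNReal.ofReal_ne_top,
            lintegral_add_left ((hFm x).lintegral_prod_right'.const_mul 2),
            lintegral_const_mul _ (hFm x).lintegral_prod_right']
      _ ≤ ENNReal.ofReal (a ^ p * 2 ^ p) * (2 * (ENNReal.ofReal κ * parabolicNorm x t ^ (-α)) +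
            2 * (ENNReal.ofReal κ * parabolicNorm (x - z) t ^ (-α))) := by
          have hKF : ∀ w, ∫⁻ s in Ioo 0 t, ∫⁻ y, F w (s, y) ≤
              ENNReal.ofReal κ * parabolicNorm w t ^ (-α) := by
            intro w
            rw [hF]
            exact (hH₂ w t ht).trans (mul_le_mul' (le_add_self.trans hK) le_rfl)
          refine mul_le_mul' le_rfl (add_le_add (mul_le_mul' le_rfl (hKF x)) ?_)
          exact (hKF (x - z)).trans (le_mul_of_one_le_left' (by norm_num))
      _ = ENNReal.ofReal (a ^ p * 2 ^ p) * (2 * ENNReal.ofReal κ) * twoCentreProfile α z x t := by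
          rw [twoCentreProfile]
          ring
      _ = _ := by
          have h2κ : 2 * ENNReal.ofReal κ = ENNReal.ofReal (2 * κ) := by
            rw [ENNReal.ofReal_mul zero_le_two, ENNReal.ofReal_ofNat]
          rw [h2κ, ← ENNReal.ofReal_mul (by positivity), hap]
  calc _ ≤ _ := add_le_add hlin hnonlin
    _ = ENNReal.ofReal a * twoCentreProfile α z x t := by
      rw [← add_mul, ← ENNReal.ofReal_add (by positivity) (by positivity), add_halves]

theorem lintegral_eheatKernel_prod (N : ℕ) (x : EuclideanSpace ℝ (Fin N)) (t : ℝ)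
    {f : ℝ × EuclideanSpace ℝ (Fin N) → ENNReal} (hf : Measurable f) :
    ∫⁻ r, eheatKernel N (x - r.2) (t - r.1) * f r ∂((volume.restrict (Ioi 0)).prod volume) =
      ∫⁻ s in Ioo 0 t, ∫⁻ y, eheatKernel N (x - y) (t - s) * f (s, y) := by
  have hm : Measurable fun r : ℝ × EuclideanSpace ℝ (Fin N) =>
      eheatKernel N (x - r.2) (t - r.1) * f r :=
    Measurable.mul ((measurable_eheatKernel N).comp (g := fun q => _)
      (f := fun r : ℝ × EuclideanSpace ℝ (Fin N) => (x - r.2, t - r.1)) (by fun_prop)) hf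
  rw [lintegral_prod _ hm.aemeasurable, ← Ioi_inter_Iio, inter_comm,
    ← setLIntegral_indicator measurableSet_Iio]
  refine lintegral_congr fun s => ?_
  by_cases hs : s < t
  · simp [indicator, hs]
  · have : ∀ y, eheatKernel N (x - y) (t - s) = 0 :=
      fun y => eheatKernel_of_nonpos N _ (by linarith)
    simp [indicator, hs, this]

theorem integral_heatKernel_mul (N : ℕ) (x : EuclideanSpace ℝ (Fin N)) {t : ℝ} (ht : 0 < t)
    {f : EuclideanSpace ℝ (Fin N) → ℝ} (hf : Measurable f) (hf0 : ∀ y, 0 ≤ f y) :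
    ∫ y, heatKernel N (x - y) t * f y =
      (∫⁻ y, eheatKernel N (x - y) t * ENNReal.ofReal (f y)).toReal := by
  have hm : Measurable fun y : EuclideanSpace ℝ (Fin N) => heatKernel N (x - y) t :=
    (measurable_heatKernel N).comp (g := fun q => _)
      (f := fun y : EuclideanSpace ℝ (Fin N) => (x - y, t)) (by fun_prop)
  rw [integral_eq_lintegral_of_nonneg_ae
    (.of_forall fun y => mul_nonneg (heatKernel_nonneg N _ ht.le) (hf0 y))
    (hm.mul hf).aestronglyMeasurable]
  congr 1
  refine lintegral_congr fun y => ?_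
  rw [eheatKernel_of_pos N _ ht, ENNReal.ofReal_mul (heatKernel_nonneg N _ ht.le)]

theorem isGlobalSol_toReal {N : ℕ} (hN : 1 ≤ N) {γ p : ℝ} (hp : 0 ≤ p)
    {u₀ : EuclideanSpace ℝ (Fin N) → ℝ} (hu₀ : Measurable u₀) (hu₀' : ∀ x, 0 ≤ u₀ x)
    {u : ℝ × EuclideanSpace ℝ (Fin N) → ENNReal} (hu : Measurable u)
    (hfin : ∀ x t, 0 < t → u (t, x) ≠ ⊤)
    (heq : ∀ x t, 0 < t → u (t, x) = (∫⁻ y, eheatKernel N (x - y) t * ENNReal.ofReal (u₀ y)) +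
      ∫⁻ s in Ioo 0 t, ∫⁻ y, eheatKernel N (x - y) (t - s) * (‖y‖ₑ ^ (-γ) * u (s, y) ^ p)) :
    IsGlobalSol N γ p u₀ fun x t => (u (t, x)).toReal := by
  have : Nonempty (Fin N) := ⟨⟨0, hN⟩⟩
  refine ⟨(hu.comp measurable_swap).ennreal_toReal, fun x t => ENNReal.toReal_nonneg,
    .of_forall ?_⟩
  rintro ⟨x, t⟩ ht
  dsimp only at ht ⊢
  have hut := heq x t ht
  have hne := hfin x t ht
  rw [hut] at hne
  obtain ⟨hne₁, hne₂⟩ := ENNReal.add_ne_top.1 hne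
  rw [hut, ENNReal.toReal_add hne₁ hne₂, integral_heatKernel_mul N x ht hu₀ hu₀']
  congr 1
  set I : ℝ → ENNReal := fun s =>
    ∫⁻ y, eheatKernel N (x - y) (t - s) * (‖y‖ₑ ^ (-γ) * u (s, y) ^ p) with hI
  have hIm : Measurable I := by
    refine Measurable.lintegral_prod_right' (f := fun r : ℝ × EuclideanSpace ℝ (Fin N) =>
      eheatKernel N (x - r.2) (t - r.1) * (‖r.2‖ₑ ^ (-γ) * u r ^ p)) ?_
    exact Measurable.mul ((measurable_eheatKernel N).comp (g := fun q => _)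
      (f := fun r : ℝ × EuclideanSpace ℝ (Fin N) => (x - r.2, t - r.1)) (by fun_prop))
      (by fun_prop)
  rw [← integral_toReal hIm.aemeasurable (ae_lt_top hIm hne₂)]
  refine setIntegral_congr_fun measurableSet_Ioo fun s hs => ?_
  have hts : 0 < t - s := by linarith [hs.2]
  have hus : Measurable fun y => u (s, y) := hu.comp measurable_prodMk_left
  have h := integral_heatKernel_mul N x hts
    (f := fun y => ‖y‖ ^ (-γ) * (u (s, y)).toReal ^ p) (by fun_prop) (fun y => by positivity)
  simp only [mul_assoc]
  rw [h, hI]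
  congr 1
  refine lintegral_congr_ae ?_
  filter_upwards [ae_enorm_rpow_eq_ofReal
    (volume : Measure (EuclideanSpace ℝ (Fin N))) (-γ)] with y hy
  rw [hy, ENNReal.ofReal_mul (by positivity), ENNReal.toReal_rpow,
    ENNReal.ofReal_toReal (ENNReal.rpow_ne_top_of_nonneg hp (hfin y s hs.1))]

theorem statement5 (N : ℕ) (hN : 1 ≤ N) (γ p : ℝ)
    (hγ0 : 0 < γ) (hγ : γ < min 2 (N : ℝ)) (hp : 1 + (2 - γ) / (N : ℝ) < p) :
    ∃ cstar : ℝ, 0 < cstar ∧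
      ∀ (z : EuclideanSpace ℝ (Fin N)),
      ∀ (u₀ : EuclideanSpace ℝ (Fin N) → ℝ) (c : ℝ),
        Measurable u₀ → (∀ x, 0 ≤ u₀ x) →
        0 < c → c ≤ cstar →
        (∀ x, x ≠ z → u₀ x ≤ c * ‖x - z‖ ^ (-(2 - γ) / (p - 1))) →
        ∃ u, IsGlobalSol N γ p u₀ u := by
  obtain ⟨hγ2, hγN⟩ := lt_min_iff.1 hγ
  have hN0 : (0 : ℝ) < N := by exact_mod_cast hN
  have hpN : (2 - γ) / N < p - 1 := by linarith
  have hp1 : 0 < p - 1 := (div_pos (by linarith) hN0).trans hpN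
  obtain ⟨α, hα⟩ : ∃ α : ℝ, α = (2 - γ) / (p - 1) := ⟨_, rfl⟩
  have hα0 : 0 < α := by rw [hα]; exact div_pos (by linarith) hp1
  have hαN : α < N := by
    rw [hα, div_lt_iff₀ hp1]
    rw [div_lt_iff₀ hN0] at hpN
    linarith
  have hαp : α * p = α + 2 - γ := by
    rw [hα]
    field_simp
    ring
  have hα' : -(2 - γ) / (p - 1) = -α := by rw [hα, neg_div]
  obtain ⟨cstar, A, hc, hA, hsuper⟩ :=
    exists_supersolution hN hγ0 hγ2 hγN hα0 hαN (by linarith) hαp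
  refine ⟨cstar, hc, fun z u₀ c hu₀ hu₀' hc0 hcc hbd => ?_⟩
  rw [hα'] at hbd
  have hv : ∀ y, ENNReal.ofReal (u₀ y) ≤ ENNReal.ofReal cstar * ‖y - z‖ₑ ^ (-α) := by
    intro y
    by_cases hy : y = z
    · rw [hy, sub_self, enorm_zero, ENNReal.zero_rpow_of_neg (by linarith),
        ENNReal.mul_top (by simpa using hc)]
      exact le_top
    · have hyz : 0 < ‖y - z‖ := norm_pos_iff.2 (sub_ne_zero.2 hy)
      rw [← ofReal_norm, ENNReal.ofReal_rpow_of_pos hyz, ← ENNReal.ofReal_mul hc.le]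
      exact ENNReal.ofReal_le_ofReal ((hbd y hy).trans (by gcongr))
  have ha : Measurable fun q : ℝ × EuclideanSpace ℝ (Fin N) =>
      ∫⁻ y, eheatKernel N (q.2 - y) q.1 * ENNReal.ofReal (u₀ y) := by
    refine Measurable.lintegral_prod_right'
      (f := fun r : (ℝ × EuclideanSpace ℝ (Fin N)) × EuclideanSpace ℝ (Fin N) =>
        eheatKernel N (r.1.2 - r.2) r.1.1 * ENNReal.ofReal (u₀ r.2)) ?_
    exact Measurable.mul ((measurable_eheatKernel N).comp (g := fun q => _)
      (f := fun r : (ℝ × EuclideanSpace ℝ (Fin N)) × EuclideanSpace ℝ (Fin N) =>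
        (r.1.2 - r.2, r.1.1)) (by fun_prop)) (by fun_prop)
  have hk : Measurable (Function.uncurry fun q r : ℝ × EuclideanSpace ℝ (Fin N) =>
      eheatKernel N (q.2 - r.2) (q.1 - r.1) * ‖r.2‖ₑ ^ (-γ)) := by
    exact Measurable.mul ((measurable_eheatKernel N).comp (g := fun q => _)
      (f := fun r : (ℝ × EuclideanSpace ℝ (Fin N)) × ℝ × EuclideanSpace ℝ (Fin N) =>
        (r.1.2 - r.2.2, r.1.1 - r.2.1)) (by fun_prop)) (by fun_prop)
  have hprofile : Measurable fun r : ℝ × EuclideanSpace ℝ (Fin N) =>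
      A * twoCentreProfile α z r.2 r.1 := by
    refine Measurable.const_mul (Measurable.add ?_ ?_) A
    · exact (measurable_parabolicNorm.comp measurable_swap).pow_const _
    · exact (measurable_parabolicNorm.comp (g := fun q => _)
        (f := fun r : ℝ × EuclideanSpace ℝ (Fin N) => (r.2 - z, r.1)) (by fun_prop)).pow_const _
  have hduhamel : ∀ (w : ℝ × EuclideanSpace ℝ (Fin N) → ENNReal), Measurable w →
      ∀ q : ℝ × EuclideanSpace ℝ (Fin N),
      ∫⁻ r, eheatKernel N (q.2 - r.2) (q.1 - r.1) * ‖r.2‖ₑ ^ (-γ) * w r ^ p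
        ∂((volume.restrict (Ioi 0)).prod volume) =
      ∫⁻ s in Ioo 0 q.1, ∫⁻ y, eheatKernel N (q.2 - y) (q.1 - s) *
        (‖y‖ₑ ^ (-γ) * w (s, y) ^ p) := by
    intro w hw q
    simp only [mul_assoc]
    exact lintegral_eheatKernel_prod N q.2 q.1 (f := fun r => ‖r.2‖ₑ ^ (-γ) * w r ^ p)
      (by fun_prop)
  obtain ⟨u, hu, huU, hueq⟩ := exists_measurable_fixedPoint
    ((volume.restrict (Ioi (0 : ℝ))).prod (volume : Measure (EuclideanSpace ℝ (Fin N))))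
    (by linarith : 0 < p) ha hk (U := fun r => A * twoCentreProfile α z r.2 r.1) (by
      rintro ⟨t, x⟩
      rw [hduhamel _ hprofile]
      rcases le_or_gt t 0 with ht | ht
      · simp [Ioo_eq_empty ht.not_gt, eheatKernel_of_nonpos N _ ht]
      · exact hsuper z _ hv x t ht)
  refine ⟨_, isGlobalSol_toReal hN (by linarith) hu₀ hu₀' hu (fun x t ht => ?_)
    fun x t _ => (hueq (t, x)).trans (congrArg _ (hduhamel u hu (t, x)))⟩
  have hV : ∀ w : EuclideanSpace ℝ (Fin N), parabolicNorm w t ^ (-α) ≠ ⊤ := fun w =>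
    ENNReal.rpow_ne_top_of_ne_zero (parabolicNorm_ne_zero w ht) (parabolicNorm_ne_top w ht)
  exact ne_top_of_le_ne_top
    (ENNReal.mul_ne_top hA (ENNReal.add_ne_top.2 ⟨hV x, hV (x - z)⟩)) (huU (t, x))
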